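/- Let λ, μ ∈ ℝ with μ > 0, λ + μ > 0 and λ + 2μ > 0, set α := (λ+μ)/(λ+3μ), let R > 0 and let k ≥ 1 be an integer. Let ψ̂_k : ℝ² → ℝ² be defined by ψ̂_k(x) = (r^k cos(kθ), −r^k sin(kθ)) for r ≤ R and ψ̂_k(x) = R^{2k}( r^{−k} cos(kθ) + kα(r²−R²) r^{−k−2} cos((k+2)θ), −r^{−k} sin(kθ) + kα(r²−R²) r^{−k−2} sin((k+2)θ) ) for r > R. Then ∫_{ℝ²} [ λ (∇·ψ̂_k)² + 2μ ∇^s ψ̂_k : ∇^s ψ̂_k ] dx = 8kπ · μ(λ+2μ)/(λ+3μ) · R^{2k}, where ∇^s u = (∇u + (∇u)ᵀ)/2 and ':' is the Frobenius inner product. -/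

import Mathlib

open Real MeasureTheory

noncomputable section

/-- Partial derivative in the first coordinate direction. -/
def pdx (f : ℝ × ℝ → ℝ) (x : ℝ × ℝ) : ℝ := fderiv ℝ f x (1, 0)

/-- Partial derivative in the second coordinate direction. -/
def pdy (f : ℝ × ℝ → ℝ) (x : ℝ × ℝ) : ℝ := fderiv ℝ f x (0, 1)

/-- Divergence of a planar vector field. -/
def div2 (u : ℝ × ℝ → ℝ × ℝ) (x : ℝ × ℝ) : ℝ :=
  pdx (fun y => (u y).1) x + pdy (fun y => (u y).2) x

/-- Componentwise Laplacian. -/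
def lap2 (f : ℝ × ℝ → ℝ) (x : ℝ × ℝ) : ℝ :=
  pdx (fun y => pdx f y) x + pdy (fun y => pdy f y) x

/-- The Lamé operator  μ Δu + (λ+μ) ∇(∇·u). -/
def lame2 (lam mu : ℝ) (u : ℝ × ℝ → ℝ × ℝ) (x : ℝ × ℝ) : ℝ × ℝ :=
  (mu * lap2 (fun y => (u y).1) x + (lam + mu) * pdx (fun y => div2 u y) x,
   mu * lap2 (fun y => (u y).2) x + (lam + mu) * pdy (fun y => div2 u y) x)

/-- Conormal derivative  λ(∇·u)ν + μ(∇u + (∇u)ᵀ)ν. -/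
def trac (lam mu : ℝ) (u : ℝ × ℝ → ℝ × ℝ) (x ν : ℝ × ℝ) : ℝ × ℝ :=
  (lam * div2 u x * ν.1
      + mu * (2 * pdx (fun y => (u y).1) x * ν.1
        + (pdy (fun y => (u y).1) x + pdx (fun y => (u y).2) x) * ν.2),
   lam * div2 u x * ν.2
      + mu * ((pdy (fun y => (u y).1) x + pdx (fun y => (u y).2) x) * ν.1
        + 2 * pdy (fun y => (u y).2) x * ν.2))

/-- Entries of the symmetric gradient ∇ˢu = (∇u + (∇u)ᵀ)/2. -/
def sg11 (u : ℝ × ℝ → ℝ × ℝ) (x : ℝ × ℝ) : ℝ := pdx (fun y => (u y).1) x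

def sg12 (u : ℝ × ℝ → ℝ × ℝ) (x : ℝ × ℝ) : ℝ :=
  (pdy (fun y => (u y).1) x + pdx (fun y => (u y).2) x) / 2

def sg22 (u : ℝ × ℝ → ℝ × ℝ) (x : ℝ × ℝ) : ℝ := pdy (fun y => (u y).2) x

/-- Frobenius inner product ∇ˢu : ∇ˢv of the symmetric gradients of two fields. -/
def sgFrob (u v : ℝ × ℝ → ℝ × ℝ) (x : ℝ × ℝ) : ℝ :=
  sg11 u x * sg11 v x + 2 * (sg12 u x * sg12 v x) + sg22 u x * sg22 v x

/-- Euclidean norm on ℝ². -/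
def nr (x : ℝ × ℝ) : ℝ := Real.sqrt (x.1 ^ 2 + x.2 ^ 2)

/-- The identification `(x, y) ↦ x + iy` of the plane with `ℂ`. -/
def planeToComplex : ℝ × ℝ →L[ℝ] ℂ := (Complex.equivRealProdCLM.symm : ℝ × ℝ →L[ℝ] ℂ)

/-- The conjugate identification `(x, y) ↦ x - iy` of the plane with `ℂ`. -/
def planeToComplexConj : ℝ × ℝ →L[ℝ] ℂ := (Complex.conjCLE : ℂ →L[ℝ] ℂ).comp planeToComplex

lemma planeToComplex_apply (p : ℝ × ℝ) : planeToComplex p = p.1 + p.2 * Complex.I := by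
  simp [planeToComplex, Complex.equivRealProdCLM_symm_apply]

lemma planeToComplexConj_apply (p : ℝ × ℝ) : planeToComplexConj p = p.1 - p.2 * Complex.I := by
  simp [planeToComplexConj, planeToComplex_apply, sub_eq_add_neg]

/-- The elastic energy density in terms of the Wirtinger derivatives `a`, `b` of the field. -/
lemma energyDensity_eq_of_hasFDerivAt (lam mu : ℝ) {ψ : ℝ × ℝ → ℝ × ℝ} {U : ℝ × ℝ → ℂ}
    {p : ℝ × ℝ} {a b : ℂ} (hU : HasFDerivAt U (a • planeToComplex + b • planeToComplexConj) p)
    (hψ : ψ =ᶠ[nhds p] fun q => ((U q).re, (U q).im)) :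
    lam * div2 ψ p ^ 2 + 2 * mu * sgFrob ψ ψ p
      = 4 * (lam + mu) * a.re ^ 2 + 4 * mu * Complex.normSq b := by
  have h1 : HasFDerivAt (fun q => (ψ q).1)
      (Complex.reCLM.comp (a • planeToComplex + b • planeToComplexConj)) p := by
    refine (Complex.reCLM.hasFDerivAt.comp p hU).congr_of_eventuallyEq ?_
    filter_upwards [hψ] with q hq
    simp [hq]
  have h2 : HasFDerivAt (fun q => (ψ q).2)
      (Complex.imCLM.comp (a • planeToComplex + b • planeToComplexConj)) p := by
    refine (Complex.imCLM.hasFDerivAt.comp p hU).congr_of_eventuallyEq ?_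
    filter_upwards [hψ] with q hq
    simp [hq]
  simp only [div2, sgFrob, sg11, sg12, sg22, pdx, pdy, h1.fderiv, h2.fderiv]
  simp [planeToComplex_apply, planeToComplexConj_apply, Complex.normSq_apply]
  ring

lemma polar_pow (r θ : ℝ) (n : ℕ) :
    ((r : ℂ) * Real.cos θ + r * Real.sin θ * Complex.I) ^ n
      = (r ^ n * Real.cos (n * θ) : ℝ) + (r ^ n * Real.sin (n * θ) : ℝ) * Complex.I := by
  have := Complex.cos_add_sin_mul_I_pow n (θ : ℂ)
  rw [show (r : ℂ) * Real.cos θ + r * Real.sin θ * Complex.I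
    = r * (Complex.cos θ + Complex.sin θ * Complex.I) by push_cast; ring, mul_pow, this]
  push_cast
  ring

lemma planeToComplex_inv_polar {r : ℝ} (hr : r ≠ 0) (θ : ℝ) :
    (planeToComplex (r * Real.cos θ, r * Real.sin θ))⁻¹
      = (r⁻¹ : ℝ) * Real.cos (-θ) + (r⁻¹ : ℝ) * Real.sin (-θ) * Complex.I := by
  have hr' : (r : ℂ) ≠ 0 := by exact_mod_cast hr
  refine inv_eq_of_mul_eq_one_right ?_
  simp only [planeToComplex_apply, Real.cos_neg, Real.sin_neg]
  push_cast
  field_simp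
  linear_combination Complex.cos_sq_add_sin_sq θ - (Complex.sin θ) ^ 2 * Complex.I_sq

lemma planeToComplexConj_inv_polar {r : ℝ} (hr : r ≠ 0) (θ : ℝ) :
    (planeToComplexConj (r * Real.cos θ, r * Real.sin θ))⁻¹
      = (r⁻¹ : ℝ) * Real.cos θ + (r⁻¹ : ℝ) * Real.sin θ * Complex.I := by
  have hr' : (r : ℂ) ≠ 0 := by exact_mod_cast hr
  refine inv_eq_of_mul_eq_one_right ?_
  simp only [planeToComplexConj_apply]
  push_cast
  field_simp
  linear_combination Complex.cos_sq_add_sin_sq θ - (Complex.sin θ) ^ 2 * Complex.I_sq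

lemma exists_polar (p : ℝ × ℝ) : ∃ θ : ℝ,
    p = (nr p * Real.cos θ, nr p * Real.sin θ) := by
  refine ⟨Complex.arg ⟨p.1, p.2⟩, ?_⟩
  have h : nr p = ‖(⟨p.1, p.2⟩ : ℂ)‖ := by
    rw [Complex.norm_def, Complex.normSq_mk, nr]; ring_nf
  rw [h, Complex.norm_mul_cos_arg, Complex.norm_mul_sin_arg]

lemma continuous_nr : Continuous nr := by
  unfold nr; fun_prop

lemma nr_polar {r : ℝ} (hr : 0 ≤ r) (θ : ℝ) : nr (r * Real.cos θ, r * Real.sin θ) = r := by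
  rw [nr, show (r * Real.cos θ) ^ 2 + (r * Real.sin θ) ^ 2 = r ^ 2 by
    linear_combination r ^ 2 * Real.cos_sq_add_sin_sq θ, Real.sqrt_sq hr]

lemma energyDensity_inside (lam mu : ℝ) {R : ℝ} {n : ℕ} {ψ : ℝ × ℝ → ℝ × ℝ}
    (hψ : ∀ r θ : ℝ, 0 ≤ r → r ≤ R → ψ (r * Real.cos θ, r * Real.sin θ)
      = (r ^ (n + 1) * Real.cos (((n + 1 : ℕ) : ℝ) * θ),
         -(r ^ (n + 1) * Real.sin (((n + 1 : ℕ) : ℝ) * θ))))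
    {r : ℝ} (hr : 0 ≤ r) (hrR : r < R) (θ : ℝ) :
    lam * div2 ψ (r * Real.cos θ, r * Real.sin θ) ^ 2
        + 2 * mu * sgFrob ψ ψ (r * Real.cos θ, r * Real.sin θ)
      = 4 * mu * (n + 1) ^ 2 * r ^ (2 * n) := by
  have hconj (s φ : ℝ) : planeToComplexConj (s * Real.cos φ, s * Real.sin φ)
      = s * Real.cos (-φ) + s * Real.sin (-φ) * Complex.I := by
    simp [planeToComplexConj_apply, sub_eq_add_neg]
  have hd := (planeToComplexConj.hasFDerivAt
    (x := (r * Real.cos θ, r * Real.sin θ))).pow (n + 1)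
  have hev : ψ =ᶠ[nhds (r * Real.cos θ, r * Real.sin θ)]
      fun q => ((planeToComplexConj q ^ (n + 1)).re, (planeToComplexConj q ^ (n + 1)).im) := by
    filter_upwards [(isOpen_lt continuous_nr continuous_const).mem_nhds
      (show nr (r * Real.cos θ, r * Real.sin θ) < R by rwa [nr_polar hr])] with q hq
    obtain ⟨φ, hφ⟩ := exists_polar q
    have := hψ (nr q) φ (Real.sqrt_nonneg _) (le_of_lt hq)
    rw [← hφ] at this
    have h2 := hconj (nr q) φ
    rw [← hφ] at h2
    rw [this, h2, polar_pow]
    simp [-Complex.ofReal_mul, -Complex.ofReal_pow, -Nat.cast_add]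
  rw [energyDensity_eq_of_hasFDerivAt lam mu (a := 0)
    (b := (n + 1) * planeToComplexConj (r * Real.cos θ, r * Real.sin θ) ^ n)
    (hd.congr_fderiv (by ext <;> simp [mul_assoc])) hev]
  have hb : Complex.normSq (planeToComplexConj (r * Real.cos θ, r * Real.sin θ)) = r ^ 2 := by
    rw [hconj]
    simp [Complex.normSq_apply, -Complex.ofReal_cos, -Complex.ofReal_sin]
    linear_combination r ^ 2 * Real.cos_sq_add_sin_sq θ
  rw [map_mul, map_pow, hb, show ((n : ℂ) + 1) = ((n + 1 : ℝ) : ℂ) by push_cast; rfl,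
    Complex.normSq_ofReal]
  simp
  ring

lemma energyDensity_outside (lam mu α : ℝ) {R : ℝ} (hR : 0 < R) {k : ℕ} {ψ : ℝ × ℝ → ℝ × ℝ}
    (hψ : ∀ r θ : ℝ, R < r →
      ψ (r * Real.cos θ, r * Real.sin θ)
        = (R ^ (2 * k) * (Real.cos ((k : ℝ) * θ) / r ^ k
              + (k : ℝ) * α * (r ^ 2 - R ^ 2) * Real.cos (((k : ℝ) + 2) * θ) / r ^ (k + 2)),
           R ^ (2 * k) * (-(Real.sin ((k : ℝ) * θ) / r ^ k)
              + (k : ℝ) * α * (r ^ 2 - R ^ 2) * Real.sin (((k : ℝ) + 2) * θ) / r ^ (k + 2))))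
    {r : ℝ} (hrR : R < r) (θ : ℝ) :
    lam * div2 ψ (r * Real.cos θ, r * Real.sin θ) ^ 2
        + 2 * mu * sgFrob ψ ψ (r * Real.cos θ, r * Real.sin θ)
      = 4 * (lam + mu) * (R ^ (2 * k) * k * (α - 1) * (r ^ (k + 1))⁻¹
            * Real.cos (((k + 1 : ℕ) : ℝ) * θ)) ^ 2
        + 4 * mu * (R ^ (2 * k) * k * α * (r ^ (k + 3))⁻¹
            * ((k + 2) * R ^ 2 - (k + 1) * r ^ 2)) ^ 2 := by
  have hr : 0 < r := hR.trans hrR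
  set p : ℝ × ℝ := (r * Real.cos θ, r * Real.sin θ) with hp
  set z := planeToComplex p with hz
  set zb := planeToComplexConj p with hzb
  have hzzb (q : ℝ × ℝ) : planeToComplex q * planeToComplexConj q = ((nr q ^ 2 : ℝ) : ℂ) := by
    rw [nr, Real.sq_sqrt (by positivity), planeToComplex_apply, planeToComplexConj_apply]
    push_cast
    linear_combination -(q.2 : ℂ) ^ 2 * Complex.I_sq
  have hzz : z * zb = ((r ^ 2 : ℝ) : ℂ) := by rw [hzzb, nr_polar hr.le]
  have hz0 : z ≠ 0 := by
    rintro h; rw [h, zero_mul] at hzz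
    exact (pow_pos hr 2).ne (by exact_mod_cast hzz)
  have hzb0 : zb ≠ 0 := by
    rintro h; rw [h, mul_zero] at hzz
    exact (pow_pos hr 2).ne (by exact_mod_cast hzz)
  let U : ℝ × ℝ → ℂ := fun q => ((R ^ (2 * k) : ℝ) : ℂ) * ((planeToComplex q)⁻¹ ^ k
    + ((k * α : ℝ) : ℂ) * (planeToComplex q * planeToComplexConj q - ((R ^ 2 : ℝ) : ℂ))
      * (planeToComplexConj q)⁻¹ ^ (k + 2))
  have hev : ψ =ᶠ[nhds p] fun q => ((U q).re, (U q).im) := by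
    filter_upwards [(isOpen_lt continuous_const continuous_nr).mem_nhds
      (show R < nr p by rwa [nr_polar hr.le])] with q hq
    obtain ⟨φ, hφ⟩ := exists_polar q
    have hq0 : 0 < nr q := hR.trans hq
    have h1 := hψ (nr q) φ hq
    have h2 := planeToComplex_inv_polar hq0.ne' φ
    have h3 := planeToComplexConj_inv_polar hq0.ne' φ
    rw [← hφ] at h1 h2 h3
    rw [h1]
    simp only [U]
    rw [h2, h3, hzzb, polar_pow, polar_pow, ← Complex.ofReal_sub, ← Complex.ofReal_mul]
    simp [-Complex.ofReal_mul, -Complex.ofReal_pow, -Complex.ofReal_sub]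
    constructor <;> left <;> ring
  have hL : HasFDerivAt planeToComplex planeToComplex p := planeToComplex.hasFDerivAt
  have hLb : HasFDerivAt planeToComplexConj planeToComplexConj p := planeToComplexConj.hasFDerivAt
  have hw : HasFDerivAt (fun q => (planeToComplex q)⁻¹ ^ k)
      ((-(k * z⁻¹ ^ (k + 1))) • planeToComplex) p := by
    have hinv := (((hasDerivAt_inv hz0).pow k).complexToReal_fderiv).comp p hL
    refine hinv.congr_fderiv ?_
    rcases k with _ | k
    · ext <;> simp
    · ext <;> simp <;> field_simp <;> left <;> ring
  have hwb : HasFDerivAt (fun q => (planeToComplexConj q)⁻¹ ^ (k + 2))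
      ((-((k + 2) * zb⁻¹ ^ (k + 3))) • planeToComplexConj) p := by
    have hinv := (((hasDerivAt_inv hzb0).pow (k + 2)).complexToReal_fderiv).comp p hLb
    refine hinv.congr_fderiv ?_
    ext <;> simp <;> field_simp <;> left <;> ring
  have hU : HasFDerivAt U
      ((((R ^ (2 * k) : ℝ) : ℂ) * (k * (α - 1)) * z⁻¹ ^ (k + 1)
        + ((R ^ (2 * k) : ℝ) : ℂ) * (k * α) * (zb⁻¹ ^ (k + 1) - z⁻¹ ^ (k + 1))) • planeToComplex
      + (((R ^ (2 * k) * k * α * ((k + 2) * R ^ 2 - (k + 1) * r ^ 2) : ℝ) : ℂ)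
        * zb⁻¹ ^ (k + 3)) • planeToComplexConj) p := by
    have h := (hw.add (((hL.mul hLb).sub_const ((R ^ 2 : ℝ) : ℂ)).const_mul
      ((k * α : ℝ) : ℂ) |>.mul hwb)).const_mul ((R ^ (2 * k) : ℝ) : ℂ)
    refine h.congr_fderiv ?_
    have hr2 : (r : ℂ) ^ 2 = z * zb := by rw [hzz]; push_cast; rfl
    ext <;> simp [← hz, ← hzb, hr2] <;> field_simp <;> ring
  rw [energyDensity_eq_of_hasFDerivAt lam mu hU hev]
  rw [hz, hzb, hp, planeToComplex_inv_polar hr.ne', planeToComplexConj_inv_polar hr.ne',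
    polar_pow, polar_pow, polar_pow]
  congr 1
  · congr 2
    rw [show ((k : ℂ) * (α - 1)) = ((k * (α - 1) : ℝ) : ℂ) by push_cast; rfl,
      show ((k : ℂ) * α) = ((k * α : ℝ) : ℂ) by push_cast; rfl, ← Complex.ofReal_mul,
      ← Complex.ofReal_mul]
    simp [-Complex.ofReal_mul, -Complex.ofReal_pow, -Complex.ofReal_sub, -Nat.cast_add]
    ring
  · rw [map_mul, Complex.normSq_ofReal, Complex.normSq_add_mul_I]
    linear_combination 4 * mu * (R ^ (2 * k) * k * α * r⁻¹ ^ (k + 3)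
      * ((k + 2) * R ^ 2 - (k + 1) * r ^ 2)) ^ 2
        * Real.cos_sq_add_sin_sq (((k + 3 : ℕ) : ℝ) * θ)

lemma integrableOn_Ioi_pow_inv {R : ℝ} (hR : 0 < R) (n : ℕ) :
    IntegrableOn (fun r : ℝ => (r ^ (n + 2))⁻¹) (Set.Ioi R) := by
  refine (integrableOn_Ioi_rpow_of_lt (a := -((n + 2 : ℕ) : ℝ))
    (by push_cast; linarith [n.cast_nonneg (α := ℝ)]) hR).congr_fun (fun r hr => ?_)
    measurableSet_Ioi
  simp only [Real.rpow_neg (hR.trans hr).le, Real.rpow_natCast]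

lemma integral_Ioi_pow_inv {R : ℝ} (hR : 0 < R) (n : ℕ) :
    ∫ r in Set.Ioi R, (r ^ (n + 2))⁻¹ = (R ^ (n + 1))⁻¹ / (n + 1) := by
  have h := integral_Ioi_rpow_of_lt (a := -((n + 2 : ℕ) : ℝ))
    (by push_cast; linarith [n.cast_nonneg (α := ℝ)]) hR
  rw [show -((n + 2 : ℕ) : ℝ) + 1 = -((n + 1 : ℕ) : ℝ) by push_cast; ring,
    Real.rpow_neg hR.le, Real.rpow_natCast, neg_div_neg_eq] at h
  rw [← Nat.cast_add_one, ← h]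
  refine setIntegral_congr_fun measurableSet_Ioi (fun r hr => ?_)
  simp only [Real.rpow_neg (hR.trans hr).le, Real.rpow_natCast]

lemma integral_Ioo_cos_sq {m : ℕ} (hm : m ≠ 0) :
    ∫ θ in Set.Ioo (-π) π, Real.cos (m * θ) ^ 2 = π := by
  have hm' : (m : ℝ) ≠ 0 := by exact_mod_cast hm
  rw [← integral_Ioc_eq_integral_Ioo,
    ← intervalIntegral.integral_of_le (by linarith [Real.pi_pos]),
    intervalIntegral.integral_comp_mul_left (fun x => Real.cos x ^ 2) hm', integral_cos_sq]
  simp [Real.sin_nat_mul_pi]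
  field_simp

lemma polarCoord_target_ae_eq {R : ℝ} (hR : 0 < R) :
    polarCoord.target =ᵐ[volume]
      (Set.Ioo 0 R ×ˢ Set.Ioo (-π) π ∪ Set.Ioi R ×ˢ Set.Ioo (-π) π : Set (ℝ × ℝ)) := by
  have hne : ∀ᵐ p : ℝ × ℝ, p.1 ≠ R :=
    Measure.quasiMeasurePreserving_fst.ae (Measure.ae_ne volume R)
  filter_upwards [hne] with p hp
  refine propext ?_
  change p ∈ Set.Ioi (0 : ℝ) ×ˢ Set.Ioo (-π) π ↔
    p ∈ Set.Ioo 0 R ×ˢ Set.Ioo (-π) π ∪ Set.Ioi R ×ˢ Set.Ioo (-π) π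
  simp only [Set.mem_union, Set.mem_prod, Set.mem_Ioi, Set.mem_Ioo]
  constructor
  · rintro ⟨h0, h⟩
    rcases lt_or_gt_of_ne hp with h1 | h1
    · exact Or.inl ⟨⟨h0, h1⟩, h⟩
    · exact Or.inr ⟨h1, h⟩
  · rintro (⟨h0, h⟩ | ⟨h0, h⟩)
    · exact ⟨h0.1, h⟩
    · exact ⟨hR.trans h0, h⟩

/-- Integration in polar coordinates of a function which is radial inside the disk of radius `R`,
and whose angular dependence outside of it is through `cos (m θ) ^ 2`. -/
lemma integral_eq_of_polar {R : ℝ} (hR : 0 < R) {m : ℕ} (hm : m ≠ 0) {f : ℝ × ℝ → ℝ}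
    {A B C : ℝ → ℝ} (hA : IntegrableOn A (Set.Ioo 0 R)) (hB : IntegrableOn B (Set.Ioi R))
    (hC : IntegrableOn C (Set.Ioi R))
    (hin : ∀ r θ : ℝ, 0 < r → r < R → r * f (r * Real.cos θ, r * Real.sin θ) = A r)
    (hout : ∀ r θ : ℝ, R < r →
      r * f (r * Real.cos θ, r * Real.sin θ) = B r + C r * Real.cos (m * θ) ^ 2) :
    ∫ x, f x = 2 * π * (∫ r in Set.Ioo 0 R, A r) + 2 * π * (∫ r in Set.Ioi R, B r)
      + π * ∫ r in Set.Ioi R, C r := by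
  set T : Set ℝ := Set.Ioo (-π) π with hT
  set F : ℝ × ℝ → ℝ := fun p => p.1 • f (polarCoord.symm p) with hF
  have hprod {s : Set ℝ} {g h : ℝ → ℝ} (hg : IntegrableOn g s) (hh : IntegrableOn h T) :
      IntegrableOn (fun p : ℝ × ℝ => g p.1 * h p.2) (s ×ˢ T) := by
    rw [IntegrableOn, Measure.volume_eq_prod, ← Measure.prod_restrict]
    exact Integrable.mul_prod hg hh
  have hone : IntegrableOn (fun _ : ℝ => (1 : ℝ)) T := by simp [hT, integrableOn_const_iff]
  have hcos : IntegrableOn (fun θ : ℝ => Real.cos (m * θ) ^ 2) T :=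
    (Continuous.integrableOn_Icc (by fun_prop)).mono_set Set.Ioo_subset_Icc_self
  have hTone : ∫ _ in T, (1 : ℝ) = 2 * π := by
    simp [hT, Real.pi_pos.le]; ring
  have hin' : Set.EqOn (fun p : ℝ × ℝ => A p.1 * 1) F (Set.Ioo 0 R ×ˢ T) := by
    rintro ⟨r, θ⟩ ⟨hr, -⟩
    simp [hF, ← hin r θ hr.1 hr.2]
  have hout' : Set.EqOn (fun p : ℝ × ℝ => B p.1 * 1 + C p.1 * Real.cos (m * p.2) ^ 2) F
      (Set.Ioi R ×ˢ T) := by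
    rintro ⟨r, θ⟩ ⟨hr, -⟩
    simp [hF, ← hout r θ hr]
  have hmin : MeasurableSet (Set.Ioo 0 R ×ˢ T) := measurableSet_Ioo.prod measurableSet_Ioo
  have hmout : MeasurableSet (Set.Ioi R ×ˢ T) := measurableSet_Ioi.prod measurableSet_Ioo
  have hdisj : Disjoint (Set.Ioo 0 R ×ˢ T) (Set.Ioi R ×ˢ T) := by
    refine Set.disjoint_left.2 ?_
    rintro p ⟨h1, -⟩ ⟨h2, -⟩
    exact lt_asymm h1.2 h2
  rw [← integral_comp_polarCoord_symm, setIntegral_congr_set (polarCoord_target_ae_eq hR),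
    setIntegral_union hdisj hmout ((hprod hA hone).congr_fun hin' hmin)
      (((hprod hB hone).add (hprod hC hcos)).congr_fun hout' hmout),
    ← setIntegral_congr_fun hmin hin', ← setIntegral_congr_fun hmout hout',
    integral_add (hprod hB hone) (hprod hC hcos), Measure.volume_eq_prod,
    setIntegral_prod_mul A (fun _ => 1), setIntegral_prod_mul B (fun _ => 1),
    setIntegral_prod_mul C (fun θ => Real.cos (m * θ) ^ 2), hTone, integral_Ioo_cos_sq hm]
  ring

/-- the elastic energy of the perfect plasmon elastic wave ψ̂_k over ℝ² equals
8kπ μ(λ+2μ)/(λ+3μ) R^{2k}. -/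
theorem plasmon_wave_energy (lam mu : ℝ) (hmu : 0 < mu) (hlm : 0 < lam + mu)
    (hl2m : 0 < lam + 2 * mu) (α : ℝ) (hα : α = (lam + mu) / (lam + 3 * mu))
    (R : ℝ) (hR : 0 < R) (k : ℕ) (hk : 1 ≤ k)
    (ψ : ℝ × ℝ → ℝ × ℝ)
    (hψin : ∀ r θ : ℝ, 0 ≤ r → r ≤ R →
      ψ (r * Real.cos θ, r * Real.sin θ)
        = (r ^ k * Real.cos ((k : ℝ) * θ), -(r ^ k * Real.sin ((k : ℝ) * θ))))
    (hψout : ∀ r θ : ℝ, R < r →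
      ψ (r * Real.cos θ, r * Real.sin θ)
        = (R ^ (2 * k) * (Real.cos ((k : ℝ) * θ) / r ^ k
              + (k : ℝ) * α * (r ^ 2 - R ^ 2) * Real.cos (((k : ℝ) + 2) * θ) / r ^ (k + 2)),
           R ^ (2 * k) * (-(Real.sin ((k : ℝ) * θ) / r ^ k)
              + (k : ℝ) * α * (r ^ 2 - R ^ 2) * Real.sin (((k : ℝ) + 2) * θ) / r ^ (k + 2)))) :
    ∫ x : ℝ × ℝ, (lam * div2 ψ x ^ 2 + 2 * mu * sgFrob ψ ψ x)
      = 8 * (k : ℝ) * Real.pi * (mu * (lam + 2 * mu) / (lam + 3 * mu)) * R ^ (2 * k) := by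
  obtain ⟨n, rfl⟩ : ∃ n, k = n + 1 := ⟨k - 1, by omega⟩
  have hs : lam + 3 * mu ≠ 0 := by linarith
  have hintA : IntegrableOn (fun r : ℝ => 4 * mu * (n + 1) ^ 2 * r ^ (2 * n + 1)) (Set.Ioo 0 R) :=
    (Continuous.integrableOn_Icc (by fun_prop)).mono_set Set.Ioo_subset_Icc_self
  have h3 := integrableOn_Ioi_pow_inv hR (2 * n + 1)
  have h5 := integrableOn_Ioi_pow_inv hR (2 * n + 3)
  have h7 := integrableOn_Ioi_pow_inv hR (2 * n + 5)
  set c : ℝ := 4 * mu * (R ^ (2 * (n + 1)) * (n + 1) * α) ^ 2 with hc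
  set d : ℝ := 4 * (lam + mu) * (R ^ (2 * (n + 1)) * (n + 1) * (α - 1)) ^ 2 with hd
  have hB1 := h7.const_mul (c * (n + 3) ^ 2 * R ^ 4)
  have hB2 := h5.const_mul (c * (2 * (n + 2) * (n + 3)) * R ^ 2)
  have hB3 := h3.const_mul (c * (n + 2) ^ 2)
  have hintA' : ∫ r in Set.Ioo 0 R, 4 * mu * (n + 1) ^ 2 * r ^ (2 * n + 1)
      = 4 * mu * (n + 1) ^ 2 * (R ^ (2 * n + 2) / (2 * n + 2)) := by
    rw [integral_const_mul, ← integral_Ioc_eq_integral_Ioo,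
      ← intervalIntegral.integral_of_le hR.le, integral_pow]
    push_cast
    ring
  rw [integral_eq_of_polar hR (m := n + 1 + 1) (by omega) hintA ((hB1.sub hB2).add hB3)
    (h3.const_mul d) (fun r θ h0 h1 => ?_) (fun r θ h1 => ?_)]
  · rw [hintA', integral_add' (hB1.sub hB2) hB3, integral_sub' hB1 hB2, integral_const_mul,
      integral_const_mul, integral_const_mul, integral_const_mul, integral_Ioi_pow_inv hR,
      integral_Ioi_pow_inv hR, integral_Ioi_pow_inv hR, hc, hd, hα]
    push_cast
    have hn2 : (2 * n + 1 + 1 : ℝ) ≠ 0 := by positivity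
    have hn4 : (2 * n + 3 + 1 : ℝ) ≠ 0 := by positivity
    have hn6 : (2 * n + 5 + 1 : ℝ) ≠ 0 := by positivity
    obtain ⟨s, hls⟩ : ∃ s, lam = s - 3 * mu := ⟨lam + 3 * mu, by ring⟩
    rw [hls, sub_add_cancel] at hs
    rw [hls, sub_add_cancel]
    field_simp
    ring
  · rw [energyDensity_inside lam mu hψin h0.le h1]
    ring
  · have hr0 : r ≠ 0 := (hR.trans h1).ne'
    rw [energyDensity_outside lam mu α hR hψout h1]
    simp only [Pi.add_apply, Pi.sub_apply, hc, hd]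
    push_cast
    field_simp
    ring
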